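/- Let p ∈ [3,5), M > 0, and suppose C₁, C_{1/2} > 0 are constants such that for every Schwartz function v : ℝ → ℂ one has ∫_ℝ|v|^{p+1} ≤ C₁ (∫_ℝ|v|²)^{(p+3)/4} (∫_ℝ|v′|²)^{(p−1)/4} and ∫_ℝ|v|^{p+1} ≤ C_{1/2} (∫_ℝ|v|²) (∫_ℝ 2π|ξ| |v̂(ξ)|² dξ)^{(p−1)/2}, and that C₁ can be taken so that moreover C₁ ≥ the quotient ∫_ℝ Q^{p+1} / ((∫_ℝ Q²)^{(p+3)/4}(∫_ℝ (Q′)²)^{(p−1)/4}) for every positive Schwartz solution Q of −Q″ − Q^p = −μQ with μ > 0; set α = (2^{3(p+1)/2}/(p+1)) max{C₁, C_{1/2}}. Let c ≥ max{ (αM)^{(p−1)/(5−p)}, (α^{4/(p+3)}M)^{(p−1)/(5−p)} }. Then the infimum of 𝓔_c(u) over all Schwartz functions u : ℝ → ℂ with 𝓜(u) = M and K_c(u) ≤ c^{(p+3)/(p−1)} is equal to the infimum of 𝓔_c(u) over all Schwartz functions u : ℝ → ℂ with 𝓜(u) = M and K_c(u) ≤ α^{4/(5−p)} M^{(p+3)/(5−p)}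 (both infima taken in the extended reals). -/

import Mathlib

open Real MeasureTheory SchwartzMap FourierTransform

/-- The symbol of the pseudo-relativistic operator. -/
noncomputable def mSym (c ξ : ℝ) : ℝ := Real.sqrt (c ^ 2 * ξ ^ 2 + c ^ 4 / 4) - c ^ 2 / 2

/-- The mass `𝓜(u)`. -/
noncomputable def massOf (u : ℝ → ℂ) : ℝ := ∫ x : ℝ, ‖u x‖ ^ 2

/-- The relativistic kinetic energy `K_c(u)`. -/
noncomputable def kineticC (c : ℝ) (u : ℝ → ℂ) : ℝ :=
  ∫ ξ : ℝ, mSym c (2 * π * ξ) * ‖𝓕 u ξ‖ ^ 2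

/-- The relativistic energy `𝓔_c(u)`. -/
noncomputable def energyC (c p : ℝ) (u : ℝ → ℂ) : ℝ :=
  (1 / 2) * kineticC c u - (1 / (p + 1)) * ∫ x : ℝ, ‖u x‖ ^ (p + 1)

lemma mSym_nonneg {c : ℝ} (η : ℝ) : 0 ≤ mSym c η := by
  unfold mSym
  rw [sub_nonneg]
  apply Real.le_sqrt_of_sq_le
  nlinarith [sq_nonneg (c * η)]

lemma mSym_le {c : ℝ} (η : ℝ) : mSym c η ≤ η ^ 2 := by
  unfold mSym
  rw [sub_le_iff_le_add, Real.sqrt_le_left (by positivity)]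
  nlinarith [sq_nonneg (η ^ 2)]

lemma mSym_low {c η : ℝ} (hc : 0 < c) (h : |η| ≤ 2 * c) : η ^ 2 ≤ 4 * mSym c η := by
  have h2 : η ^ 2 ≤ 12 * c ^ 2 := by
    rw [← sq_abs]; nlinarith [abs_nonneg η]
  have : η ^ 2 / 4 + c ^ 2 / 2 ≤ Real.sqrt (c ^ 2 * η ^ 2 + c ^ 4 / 4) := by
    apply Real.le_sqrt_of_sq_le
    nlinarith [mul_le_mul_of_nonneg_left h2 (sq_nonneg η)]
  unfold mSym
  linarith

lemma mSym_high {c η : ℝ} (hc : 0 < c) (h : c ≤ |η|) : c * |η| ≤ 2 * mSym c η := by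
  have : c * |η| / 2 + c ^ 2 / 2 ≤ Real.sqrt (c ^ 2 * η ^ 2 + c ^ 4 / 4) := by
    apply Real.le_sqrt_of_sq_le
    rw [← sq_abs η]
    have : c ^ 2 * |η| * c ≤ c ^ 2 * |η| * |η| := by gcongr
    nlinarith [sq_nonneg (c * |η|)]
  unfold mSym
  linarith

lemma int_sq (v : SchwartzMap ℝ ℂ) : Integrable (fun x => ‖v x‖ ^ 2) := by
  have := (v.memLp 2).integrable_norm_rpow (by simp) (by simp)
  simpa using this

lemma plancherel' (v : SchwartzMap ℝ ℂ) : ∫ ξ, ‖𝓕 (⇑v) ξ‖ ^ 2 = ∫ x, ‖v x‖ ^ 2 := by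
  rw [← SchwartzMap.integral_norm_sq_fourier, SchwartzMap.fourier_coe]

lemma int_four_sq (v : SchwartzMap ℝ ℂ) : Integrable (fun x => ‖𝓕 (⇑v) x‖ ^ 2) := by
  rw [← SchwartzMap.fourier_coe]
  exact int_sq _

lemma deriv_coe (v : SchwartzMap ℝ ℂ) : ⇑(SchwartzMap.derivCLM ℂ ℂ v) = deriv ⇑v := by
  ext x; exact SchwartzMap.derivCLM_apply ℂ v x

lemma four_deriv (v : SchwartzMap ℝ ℂ) (ξ : ℝ) :
    ‖𝓕 (⇑(SchwartzMap.derivCLM ℂ ℂ v)) ξ‖ ^ 2 = (2 * π * ξ) ^ 2 * ‖𝓕 (⇑v) ξ‖ ^ 2 := by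
  have h := Real.fourier_deriv (f := ⇑v) v.integrable v.differentiable
    (by rw [← deriv_coe]; exact SchwartzMap.integrable _)
  rw [deriv_coe, h]
  simp only [norm_smul, norm_mul, mul_pow]
  simp

lemma deriv_energy (v : SchwartzMap ℝ ℂ) :
    ∫ x, ‖deriv (⇑v) x‖ ^ 2 = ∫ ξ, (2 * π * ξ) ^ 2 * ‖𝓕 (⇑v) ξ‖ ^ 2 := by
  simp_rw [← four_deriv, plancherel', deriv_coe]

lemma int_weight (v : SchwartzMap ℝ ℂ) :
    Integrable (fun ξ => (2 * π * ξ) ^ 2 * ‖𝓕 (⇑v) ξ‖ ^ 2) := by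
  simp_rw [← four_deriv]
  exact int_four_sq _

lemma int_kin (c : ℝ) (v : SchwartzMap ℝ ℂ) :
    Integrable (fun ξ => mSym c (2 * π * ξ) * ‖𝓕 (⇑v) ξ‖ ^ 2) := by
  refine (int_weight v).mono' ?_ ?_
  · have h1 : Continuous (fun ξ : ℝ => mSym c (2 * π * ξ)) := by unfold mSym; fun_prop
    have h2 : Continuous (𝓕 (⇑v)) := by rw [← SchwartzMap.fourier_coe]; exact SchwartzMap.continuous _
    exact (h1.mul (h2.norm.pow 2)).aestronglyMeasurable
  · refine Filter.Eventually.of_forall fun ξ => ?_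
    rw [Real.norm_of_nonneg (mul_nonneg (mSym_nonneg _) (by positivity))]
    gcongr
    exact mSym_le _

lemma kin_nonneg (c : ℝ) (v : SchwartzMap ℝ ℂ) : 0 ≤ kineticC c ⇑v :=
  integral_nonneg fun ξ => mul_nonneg (mSym_nonneg _) (by positivity)

lemma kin_le (c : ℝ) (v : SchwartzMap ℝ ℂ) : kineticC c ⇑v ≤ ∫ x, ‖deriv (⇑v) x‖ ^ 2 := by
  rw [deriv_energy]
  refine integral_mono (int_kin c v) (int_weight v) fun ξ => ?_
  dsimp only
  gcongr
  exact mSym_le _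

lemma splitting {c : ℝ} (hc : 0 < c) (u : SchwartzMap ℝ ℂ) :
    ∃ a b : SchwartzMap ℝ ℂ, (∀ x, u x = a x + b x) ∧
      (∫ x, ‖a x‖ ^ 2) ≤ massOf ⇑u ∧ (∫ x, ‖b x‖ ^ 2) ≤ massOf ⇑u ∧
      (∫ x, ‖deriv (⇑a) x‖ ^ 2) ≤ 4 * kineticC c ⇑u ∧
      (∫ ξ : ℝ, 2 * π * |ξ| * ‖𝓕 (⇑b) ξ‖ ^ 2) ≤ 2 * (kineticC c ⇑u / c) := by
  have hpi := Real.pi_pos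
  let χ : ContDiffBump (0 : ℝ) := ⟨c / (2 * π), c / π, by positivity, by
    apply div_lt_div_of_pos_left hc hpi; linarith⟩
  have hχ : Function.HasTemperateGrowth (χ : ℝ → ℝ) :=
    χ.hasCompactSupport.hasTemperateGrowth χ.contDiff
  let w : SchwartzMap ℝ ℂ := SchwartzMap.smulLeftCLM ℂ (χ : ℝ → ℝ) (𝓕 u)
  have hw : ∀ ξ, w ξ = (χ ξ : ℝ) • 𝓕 (⇑u) ξ := fun ξ => by
    rw [← SchwartzMap.fourier_coe]
    exact SchwartzMap.smulLeftCLM_apply_apply hχ _ _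
  let a : SchwartzMap ℝ ℂ := 𝓕⁻ w
  have hFa : ∀ ξ, 𝓕 (⇑a) ξ = (χ ξ : ℝ) • 𝓕 (⇑u) ξ := fun ξ => by
    rw [← hw, ← SchwartzMap.fourier_coe]
    simp only [a, FourierTransform.fourier_fourierInv_eq]
  have hFb : ∀ ξ, 𝓕 (⇑(u - a)) ξ = (1 - χ ξ : ℝ) • 𝓕 (⇑u) ξ := fun ξ => by
    rw [sub_smul, one_smul, ← hFa, ← SchwartzMap.fourier_coe, ← SchwartzMap.fourier_coe,
      ← SchwartzMap.fourier_coe, sub_eq_add_neg, FourierTransform.fourier_add,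
      FourierTransform.fourier_neg]
    simp [sub_eq_add_neg]
  have n1 : ∀ ξ, ‖𝓕 (⇑a) ξ‖ ^ 2 ≤ ‖𝓕 (⇑u) ξ‖ ^ 2 := fun ξ => by
    rw [hFa, norm_smul, Real.norm_of_nonneg χ.nonneg]
    exact pow_le_pow_left₀ (mul_nonneg χ.nonneg (norm_nonneg _))
      (mul_le_of_le_one_left (norm_nonneg (𝓕 (⇑u) ξ)) χ.le_one) 2
  have n2 : ∀ ξ, ‖𝓕 (⇑(u - a)) ξ‖ ^ 2 ≤ ‖𝓕 (⇑u) ξ‖ ^ 2 := fun ξ => by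
    rw [hFb, norm_smul, Real.norm_of_nonneg (sub_nonneg.2 χ.le_one)]
    exact pow_le_pow_left₀ (mul_nonneg (sub_nonneg.2 χ.le_one) (norm_nonneg _))
      (mul_le_of_le_one_left (norm_nonneg (𝓕 (⇑u) ξ)) (sub_le_self _ χ.nonneg)) 2
  refine ⟨a, u - a, fun x => by simp, ?_, ?_, ?_, ?_⟩
  · unfold massOf
    rw [← plancherel', ← plancherel' u]
    exact integral_mono (int_four_sq _) (int_four_sq _) n1
  · unfold massOf
    rw [← plancherel', ← plancherel' u]
    exact integral_mono (int_four_sq _) (int_four_sq _) n2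
  · rw [deriv_energy, kineticC, ← integral_const_mul]
    refine integral_mono (int_weight _) ((int_kin c u).const_mul 4) fun ξ => ?_
    dsimp only
    rw [← mul_assoc]
    rcases le_or_gt (|2 * π * ξ|) (2 * c) with h | h
    · exact mul_le_mul (mSym_low hc h) (n1 ξ) (by positivity)
        (mul_nonneg (by norm_num) (mSym_nonneg _))
    · have : χ ξ = 0 := by
        apply χ.zero_of_le_dist
        rw [dist_zero_right, Real.norm_eq_abs]
        show c / π ≤ |ξ|
        rw [div_le_iff₀ hpi]
        rw [abs_mul, abs_of_pos (by positivity : 0 < 2 * π)] at h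
        nlinarith
      rw [hFa, this]
      simp only [zero_smul, norm_zero]
      have := mSym_nonneg (c := c) (2 * π * ξ)
      norm_num
      positivity
  · rw [← mul_div_assoc, kineticC, ← integral_const_mul, ← integral_div]
    refine integral_mono_of_nonneg (Filter.Eventually.of_forall fun ξ => by dsimp; positivity)
      (((int_kin c u).const_mul 2).div_const c) (Filter.Eventually.of_forall fun ξ => ?_)
    dsimp only
    rw [le_div_iff₀ hc]
    have e : |2 * π * ξ| = 2 * π * |ξ| := by
      rw [abs_mul, abs_of_pos (by positivity : 0 < 2 * π)]
    rcases le_or_gt c (|2 * π * ξ|) with h | h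
    · have := mul_le_mul (mSym_high hc h) (n2 ξ) (by positivity)
        (mul_nonneg (by norm_num) (mSym_nonneg _))
      rw [e] at this
      linarith
    · have : χ ξ = 1 := by
        apply χ.one_of_mem_closedBall
        rw [Metric.mem_closedBall, dist_zero_right, Real.norm_eq_abs]
        show |ξ| ≤ c / (2 * π)
        rw [le_div_iff₀ (by positivity)]
        rw [e] at h
        linarith
      rw [hFb, this]
      simp only [sub_self, zero_smul, norm_zero]
      have := mSym_nonneg (c := c) (2 * π * ξ)
      norm_num
      positivity

lemma rpow_split {p : ℝ} (hp : 0 ≤ p) (a b : ℂ) :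
    ‖a + b‖ ^ (p + 1) ≤ 2 ^ p * (‖a‖ ^ (p + 1) + ‖b‖ ^ (p + 1)) := by
  have h := NNReal.rpow_add_le_mul_rpow_add_rpow ‖a‖₊ ‖b‖₊ (p := p + 1) (by linarith)
  have h' : (‖a‖ + ‖b‖) ^ (p + 1) ≤ 2 ^ p * (‖a‖ ^ (p + 1) + ‖b‖ ^ (p + 1)) := by
    have := NNReal.coe_le_coe.2 h
    simpa using this
  exact (Real.rpow_le_rpow (norm_nonneg _) (norm_add_le a b) (by linarith)).trans h'

lemma int_rpow {p : ℝ} (hp : 0 ≤ p) (v : SchwartzMap ℝ ℂ) :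
    Integrable (fun x => ‖v x‖ ^ (p + 1)) := by
  have h : 0 < p + 1 := by linarith
  have := (v.memLp (ENNReal.ofReal (p + 1))).integrable_norm_rpow (by simp [h]) (by simp)
  rwa [ENNReal.toReal_ofReal h.le] at this

lemma pot_split {p : ℝ} (hp : 0 ≤ p) (u a b : SchwartzMap ℝ ℂ) (h : ∀ x, u x = a x + b x) :
    (∫ x, ‖u x‖ ^ (p + 1)) ≤ 2 ^ p * ((∫ x, ‖a x‖ ^ (p + 1)) + ∫ x, ‖b x‖ ^ (p + 1)) := by
  rw [← integral_add (int_rpow hp a) (int_rpow hp b), ← integral_const_mul]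
  refine integral_mono (int_rpow hp u) (((int_rpow hp a).add (int_rpow hp b)).const_mul _)
    fun x => ?_
  dsimp only
  rw [h]
  exact rpow_split hp _ _

lemma exists_small {M ε : ℝ} (hM : 0 < M) (hε : 0 < ε) :
    ∃ v : SchwartzMap ℝ ℂ, massOf ⇑v = M ∧ (∫ x, ‖deriv (⇑v) x‖ ^ 2) ≤ ε := by
  let χ : ContDiffBump (0 : ℝ) := ⟨1, 2, by norm_num, by norm_num⟩
  have hcs : HasCompactSupport (fun x => ((χ x : ℝ) : ℂ)) :=
    χ.hasCompactSupport.comp_left (g := fun r : ℝ => (r : ℂ)) (by simp)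
  let g : SchwartzMap ℝ ℂ := hcs.toSchwartzMap (Complex.ofRealCLM.contDiff.comp χ.contDiff)
  have hg0 : g 0 = 1 := by
    have : χ 0 = 1 := χ.one_of_mem_closedBall (by simp; exact χ.rIn_pos.le)
    show ((χ 0 : ℝ) : ℂ) = 1
    simp [this]
  have hA : 0 < ∫ x, ‖g x‖ ^ 2 := by
    refine Continuous.integral_pos_of_hasCompactSupport_nonneg_nonzero (x := 0)
      (g.continuous.norm.pow 2) ?_ (fun x => by positivity) (by simp [hg0])
    exact hcs.comp_left (g := fun z : ℂ => ‖z‖ ^ 2) (by simp)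
  set A := ∫ x, ‖g x‖ ^ 2 with hAdef
  set B := ∫ x, ‖deriv (⇑g) x‖ ^ 2 with hBdef
  have hB : 0 ≤ B := integral_nonneg fun x => by positivity
  obtain ⟨l, hl, hl2⟩ : ∃ l : ℝ, 0 < l ∧ l ^ 2 = ε * A / (M * (B + 1)) :=
    ⟨Real.sqrt (ε * A / (M * (B + 1))), Real.sqrt_pos.2 (by positivity),
      Real.sq_sqrt (by positivity)⟩
  obtain ⟨k, hk2⟩ : ∃ k : ℝ, k ^ 2 = l * M / A :=
    ⟨Real.sqrt (l * M / A), Real.sq_sqrt (by positivity)⟩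
  let e : ℝ ≃L[ℝ] ℝ := ContinuousLinearEquiv.unitsEquivAut ℝ (Units.mk0 l hl.ne')
  let v : SchwartzMap ℝ ℂ := (k : ℂ) • SchwartzMap.compCLMOfContinuousLinearEquiv ℂ e g
  have hv : ⇑v = fun x => (k : ℂ) * g (l * x) := by
    ext x
    have : e x = l * x := by
      show x * l = l * x
      exact mul_comm _ _
    show (k : ℂ) • g (e x) = _
    rw [this, smul_eq_mul]
  have hdv : ∀ x, deriv (⇑v) x = (k : ℂ) * (l * deriv (⇑g) (l * x)) := fun x => by
    rw [hv, deriv_const_mul_field, deriv_comp_mul_left]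
    simp
  refine ⟨v, ?_, ?_⟩
  · unfold massOf
    rw [hv]
    simp only [norm_mul, mul_pow]
    rw [integral_const_mul, Measure.integral_comp_mul_left (fun x => ‖g x‖ ^ 2), ← hAdef]
    rw [abs_of_pos (by positivity)]
    simp only [Complex.norm_real, Real.norm_eq_abs, sq_abs, hk2, smul_eq_mul]
    field_simp
  · simp_rw [hdv]
    simp only [norm_mul, mul_pow]
    rw [integral_const_mul, integral_const_mul,
      Measure.integral_comp_mul_left (fun x => ‖deriv (⇑g) x‖ ^ 2), ← hBdef]
    rw [abs_of_pos (by positivity)]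
    simp only [Complex.norm_real, Real.norm_eq_abs, sq_abs, hk2, smul_eq_mul]
    have : l * M / A * (l ^ 2 * (l⁻¹ * B)) = ε * (B / (B + 1)) := by
      have : l * M / A * (l ^ 2 * (l⁻¹ * B)) = l ^ 2 * M / A * B := by field_simp
      rw [this, hl2]
      field_simp
    rw [this]
    have : B / (B + 1) ≤ 1 := by rw [div_le_one (by positivity)]; linarith
    nlinarith

lemma energy_nonneg (p M : ℝ) (hp3 : 3 ≤ p) (hp5 : p < 5) (hM : 0 < M)
    (C₁ Chalf : ℝ) (hC₁ : 0 < C₁) (hChalf : 0 < Chalf)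
    (hGN1 : ∀ v : SchwartzMap ℝ ℂ,
      (∫ x : ℝ, ‖v x‖ ^ (p + 1))
        ≤ C₁ * (∫ x : ℝ, ‖v x‖ ^ 2) ^ ((p + 3) / 4)
            * (∫ x : ℝ, ‖deriv (⇑v) x‖ ^ 2) ^ ((p - 1) / 4))
    (hGN2 : ∀ v : SchwartzMap ℝ ℂ,
      (∫ x : ℝ, ‖v x‖ ^ (p + 1))
        ≤ Chalf * (∫ x : ℝ, ‖v x‖ ^ 2)
            * (∫ ξ : ℝ, 2 * π * |ξ| * ‖𝓕 (⇑v) ξ‖ ^ 2) ^ ((p - 1) / 2))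
    (α : ℝ) (hα : α = 2 ^ (3 * (p + 1) / 2) / (p + 1) * max C₁ Chalf)
    (c : ℝ) (hc0 : 0 < c) (hc : (α * M) ^ ((p - 1) / (5 - p)) ≤ c) (u : SchwartzMap ℝ ℂ)
    (hu : massOf ⇑u = M) (hK : kineticC c ⇑u ≤ c ^ ((p + 3) / (p - 1)))
    (hT : α ^ (4 / (5 - p)) * M ^ ((p + 3) / (5 - p)) ≤ kineticC c ⇑u) :
    0 ≤ energyC c p ⇑u := by
  obtain ⟨a, b, hab, ha, hb, hda, hdb⟩ := splitting hc0 u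
  rw [hu] at ha hb
  unfold energyC
  set K := kineticC c ⇑u with hKdef
  set D := max C₁ Chalf with hD
  have hD0 : 0 < D := lt_max_of_lt_left hC₁
  have hα0 : 0 < α := by rw [hα]; positivity
  have hK0 : 0 < K := lt_of_lt_of_le (by positivity) hT
  have h5 : 0 < 5 - p := by linarith
  have h1 : 0 < p - 1 := by linarith
  have hpot := pot_split (p := p) (by linarith) u a b hab
  have PL : (∫ x : ℝ, ‖a x‖ ^ (p + 1)) ≤
      D * (M ^ ((p + 3) / 4) * (2 ^ ((p - 1) / 2) * K ^ ((p - 1) / 4))) := by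
    have e4 : (2 : ℝ) ^ ((p - 1) / 2) = 4 ^ ((p - 1) / 4) := by
      rw [show (4 : ℝ) = 2 ^ (2 : ℝ) by norm_num, ← Real.rpow_mul (by norm_num)]
      congr 1; ring
    rw [e4, ← Real.mul_rpow (by norm_num) hK0.le, ← mul_assoc]
    refine (hGN1 a).trans ?_
    have i1 : 0 ≤ ∫ x : ℝ, ‖a x‖ ^ 2 := integral_nonneg fun x => by positivity
    have i2 : 0 ≤ ∫ x : ℝ, ‖deriv (⇑a) x‖ ^ 2 := integral_nonneg fun x => by positivity
    have i3 : C₁ ≤ D := le_max_left _ _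
    gcongr
  have PH : (∫ x : ℝ, ‖b x‖ ^ (p + 1)) ≤
      D * (M * (2 ^ ((p - 1) / 2) * (K / c) ^ ((p - 1) / 2))) := by
    rw [← Real.mul_rpow (by norm_num) (by positivity), ← mul_assoc]
    refine (hGN2 b).trans ?_
    have i1 : 0 ≤ ∫ x : ℝ, ‖b x‖ ^ 2 := integral_nonneg fun x => by positivity
    have i2 : 0 ≤ ∫ ξ : ℝ, 2 * π * |ξ| * ‖𝓕 (⇑b) ξ‖ ^ 2 :=
      integral_nonneg fun x => by dsimp; positivity
    have i3 : Chalf ≤ D := le_max_right _ _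
    gcongr
  have hA : α * (M ^ ((p + 3) / 4) * K ^ ((p - 1) / 4)) ≤ K := by
    have h := Real.rpow_le_rpow (by positivity) hT (by positivity : 0 ≤ (5 - p) / 4)
    rw [Real.mul_rpow (by positivity) (by positivity), ← Real.rpow_mul hα0.le,
      ← Real.rpow_mul hM.le, show 4 / (5 - p) * ((5 - p) / 4) = 1 by field_simp,
      show (p + 3) / (5 - p) * ((5 - p) / 4) = (p + 3) / 4 by field_simp, Real.rpow_one] at h
    calc α * (M ^ ((p + 3) / 4) * K ^ ((p - 1) / 4))
        = (α * M ^ ((p + 3) / 4)) * K ^ ((p - 1) / 4) := by ring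
      _ ≤ K ^ ((5 - p) / 4) * K ^ ((p - 1) / 4) := by gcongr
      _ = K := by
        rw [← Real.rpow_add hK0, show (5 - p) / 4 + (p - 1) / 4 = 1 by ring, Real.rpow_one]
  have hB : α * (M * (K / c) ^ ((p - 1) / 2)) ≤ K := by
    have h := Real.rpow_le_rpow (by positivity) hc (by positivity : 0 ≤ (5 - p) / (p - 1))
    rw [← Real.rpow_mul (by positivity),
      show (p - 1) / (5 - p) * ((5 - p) / (p - 1)) = 1 by field_simp, Real.rpow_one] at h
    have h2 := Real.rpow_le_rpow hK0.le hK (by linarith : 0 ≤ (p - 3) / 2)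
    rw [← Real.rpow_mul hc0.le] at h2
    have hKs : K ^ ((p - 1) / 2) = K ^ ((p - 3) / 2) * K := by
      nth_rewrite 3 [← Real.rpow_one K]
      rw [← Real.rpow_add hK0]
      congr 1; ring
    rw [Real.div_rpow hK0.le hc0.le, hKs]
    calc α * (M * (K ^ ((p - 3) / 2) * K / c ^ ((p - 1) / 2)))
        = (α * M) * K ^ ((p - 3) / 2) * K / c ^ ((p - 1) / 2) := by ring
      _ ≤ c ^ ((5 - p) / (p - 1)) * c ^ ((p + 3) / (p - 1) * ((p - 3) / 2)) * K
            / c ^ ((p - 1) / 2) := by gcongr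
      _ = K := by
        rw [← Real.rpow_add hc0, show (5 - p) / (p - 1) + (p + 3) / (p - 1) * ((p - 3) / 2)
          = (p - 1) / 2 by field_simp; ring]
        field_simp
  have hα4 : (2 : ℝ) ^ p * (D * 2 ^ ((p - 1) / 2)) = α * (p + 1) / 4 := by
    rw [hα]
    have : (2 : ℝ) ^ (3 * (p + 1) / 2) = 2 ^ p * 2 ^ ((p - 1) / 2) * 4 := by
      rw [show (4 : ℝ) = 2 ^ (2 : ℝ) by norm_num, ← Real.rpow_add (by norm_num),
        ← Real.rpow_add (by norm_num)]
      congr 1; ring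
    rw [this]
    have : p + 1 ≠ 0 := by linarith
    field_simp
  have hfin : (∫ x : ℝ, ‖u x‖ ^ (p + 1)) ≤ (p + 1) * (K / 2) := by
    calc (∫ x : ℝ, ‖u x‖ ^ (p + 1))
        ≤ 2 ^ p * (D * (M ^ ((p + 3) / 4) * (2 ^ ((p - 1) / 2) * K ^ ((p - 1) / 4)))
          + D * (M * (2 ^ ((p - 1) / 2) * (K / c) ^ ((p - 1) / 2)))) :=
          hpot.trans (by gcongr)
      _ = 2 ^ p * (D * 2 ^ ((p - 1) / 2)) * (M ^ ((p + 3) / 4) * K ^ ((p - 1) / 4)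
          + M * (K / c) ^ ((p - 1) / 2)) := by ring
      _ = (p + 1) / 4 * (α * (M ^ ((p + 3) / 4) * K ^ ((p - 1) / 4))
          + α * (M * (K / c) ^ ((p - 1) / 2))) := by rw [hα4]; ring
      _ ≤ (p + 1) / 4 * (K + K) := by gcongr
      _ = _ := by ring
  have : 1 / (p + 1) * (∫ x : ℝ, ‖u x‖ ^ (p + 1)) ≤ 1 / (p + 1) * ((p + 1) * (K / 2)) := by
    gcongr
  have e : 1 / (p + 1) * ((p + 1) * (K / 2)) = K / 2 := by field_simp
  linarith

theorem refined_constraint_minimization (p M : ℝ) (hp3 : 3 ≤ p) (hp5 : p < 5) (hM : 0 < M)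
    (C₁ Chalf : ℝ) (hC₁ : 0 < C₁) (hChalf : 0 < Chalf)
    (hGN1 : ∀ v : SchwartzMap ℝ ℂ,
      (∫ x : ℝ, ‖v x‖ ^ (p + 1))
        ≤ C₁ * (∫ x : ℝ, ‖v x‖ ^ 2) ^ ((p + 3) / 4)
            * (∫ x : ℝ, ‖deriv (⇑v) x‖ ^ 2) ^ ((p - 1) / 4))
    (hGN2 : ∀ v : SchwartzMap ℝ ℂ,
      (∫ x : ℝ, ‖v x‖ ^ (p + 1))
        ≤ Chalf * (∫ x : ℝ, ‖v x‖ ^ 2)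
            * (∫ ξ : ℝ, 2 * π * |ξ| * ‖𝓕 (⇑v) ξ‖ ^ 2) ^ ((p - 1) / 2))
    (hC₁sharp : ∀ μ : ℝ, 0 < μ → ∀ Q : SchwartzMap ℝ ℝ, (∀ x : ℝ, 0 < Q x) →
      (∀ x : ℝ, deriv (deriv (⇑Q)) x = μ * Q x - Q x ^ p) →
      (∫ x : ℝ, Q x ^ (p + 1)) /
          ((∫ x : ℝ, Q x ^ 2) ^ ((p + 3) / 4) * (∫ x : ℝ, deriv (⇑Q) x ^ 2) ^ ((p - 1) / 4))
        ≤ C₁)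
    (α : ℝ) (hα : α = 2 ^ (3 * (p + 1) / 2) / (p + 1) * max C₁ Chalf)
    (c : ℝ)
    (hc : max ((α * M) ^ ((p - 1) / (5 - p))) ((α ^ (4 / (p + 3)) * M) ^ ((p - 1) / (5 - p))) ≤ c) :
    sInf {e : EReal | ∃ u : SchwartzMap ℝ ℂ, massOf (⇑u) = M ∧
        kineticC c (⇑u) ≤ c ^ ((p + 3) / (p - 1)) ∧ e = (energyC c p (⇑u) : EReal)}
      = sInf {e : EReal | ∃ u : SchwartzMap ℝ ℂ, massOf (⇑u) = M ∧
          kineticC c (⇑u) ≤ α ^ (4 / (5 - p)) * M ^ ((p + 3) / (5 - p)) ∧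
          e = (energyC c p (⇑u) : EReal)} := by
  have hp1 : 0 < p + 1 := by linarith
  have h5 : 0 < 5 - p := by linarith
  have h1 : 0 < p - 1 := by linarith
  have h3 : 0 < p + 3 := by linarith
  have hD0 : 0 < max C₁ Chalf := lt_max_of_lt_left hC₁
  have hα0 : 0 < α := by rw [hα]; positivity
  have hc1 := (le_max_left _ _).trans hc
  have hc2 := (le_max_right _ _).trans hc
  have hc0 : 0 < c := lt_of_lt_of_le (by positivity) hc1
  have hT0 : 0 < α ^ (4 / (5 - p)) * M ^ ((p + 3) / (5 - p)) := by positivity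
  apply le_antisymm
  · apply sInf_le_sInf
    rintro e ⟨u, hu, hK, he⟩
    refine ⟨u, hu, hK.trans ?_, he⟩
    have h := Real.rpow_le_rpow (by positivity) hc2 (by positivity : 0 ≤ (p + 3) / (p - 1))
    rw [← Real.rpow_mul (by positivity), Real.mul_rpow (by positivity) hM.le,
      ← Real.rpow_mul hα0.le,
      show (p - 1) / (5 - p) * ((p + 3) / (p - 1)) = (p + 3) / (5 - p) by field_simp,
      show 4 / (p + 3) * ((p + 3) / (5 - p)) = 4 / (5 - p) by field_simp] at h
    exact h
  · apply le_sInf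
    rintro e ⟨u, hu, hK, rfl⟩
    by_cases hT : kineticC c ⇑u ≤ α ^ (4 / (5 - p)) * M ^ ((p + 3) / (5 - p))
    · exact sInf_le ⟨u, hu, hT, rfl⟩
    · have hE := energy_nonneg p M hp3 hp5 hM C₁ Chalf hC₁ hChalf hGN1 hGN2 α hα c hc0 hc1 u hu hK
        (not_le.1 hT).le
      refine le_trans ?_ (EReal.coe_le_coe_iff.2 hE)
      refine EReal.le_of_forall_lt_iff_le.1 fun ε hε => ?_
      have hε' : 0 < ε := by exact_mod_cast hε
      obtain ⟨v, hvM, hv⟩ := exists_small hM (lt_min hε' hT0)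
      have hkv := (kin_le c v).trans hv
      refine sInf_le_of_le (b := (energyC c p ⇑v : EReal))
        ⟨v, hvM, hkv.trans (min_le_right _ _), rfl⟩ ?_
      rw [EReal.coe_le_coe_iff]
      unfold energyC
      have i1 : 0 ≤ 1 / (p + 1) * ∫ x : ℝ, ‖v x‖ ^ (p + 1) :=
        mul_nonneg (by positivity) (integral_nonneg fun x => by positivity)
      have := hkv.trans (min_le_left _ _)
      linarith
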